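/- Let Λ be the fundamental weight with simple root α_Λ. If w ∈ W is Λ-minuscule, then m(w) = 1. If w ∈ W is Λ-cominuscule with reduced expression w = s_{α_1}···s_{α_l}, then m(w) = Π_{i=1}^{l} (α_Λ, α_Λ)/(α_i, α_i), and each factor in this product is ≥ 1. -/

import Mathlib

namespace KM

/-! ## Jeu de taquin on posets (parametrized by an order relation `r`) -/

namespace JDT

variable {P : Type}

/-- `S` is a lower set (order ideal) for the relation `r`. -/
def IsIdeal (r : P → P → Prop) (S : Set P) : Prop :=
  ∀ ⦃x y : P⦄, r x y → y ∈ S → x ∈ S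

/-- `y` covers `x` for the order relation `r`. -/
def Cov (r : P → P → Prop) (x y : P) : Prop :=
  r x y ∧ x ≠ y ∧ ∀ z : P, r x z → r z y → z = x ∨ z = y

/-- A standard tableau for the order relation `r`: a finite set of boxes, labelled
strictly increasingly (w.r.t. `r`) and bijectively by `{1, …, n}`. -/
structure Tab (r : P → P → Prop) where
  dom : Set P
  finite : dom.Finite
  lab : P → ℕ
  mono : ∀ ⦃x y : P⦄, x ∈ dom → y ∈ dom → r x y → x ≠ y → lab x < lab y
  bij : Set.BijOn lab dom (Set.Icc 1 dom.ncard)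

/-- A configuration occurring during a jeu de taquin slide: a set of labelled boxes,
the labelling, and the position of the vacant box. -/
structure Cfg (P : Type) where
  dom : Set P
  lab : P → ℕ
  hole : P

/-- One elementary move inside a jeu de taquin slide: among the labelled boxes covering
the vacant box, the one with the smallest label moves its label into the vacant box,
becoming itself vacant. -/
def InnerStep (r : P → P → Prop) (s t : Cfg P) : Prop :=
  t.hole ∈ s.dom ∧ Cov r s.hole t.hole ∧
  (∀ z ∈ s.dom, Cov r s.hole z → s.lab t.hole ≤ s.lab z) ∧
  t.dom = insert s.hole (s.dom \ {t.hole}) ∧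
  t.lab s.hole = s.lab t.hole ∧ (∀ z : P, z ≠ s.hole → t.lab z = s.lab z)

/-- No labelled box covers the vacant box: the slide stops. -/
def Terminal (r : P → P → Prop) (s : Cfg P) : Prop :=
  ∀ z ∈ s.dom, ¬ Cov r s.hole z

/-- `x` is a valid vacant box to slide into: it lies strictly below some labelled box,
and is maximal among the unlabelled boxes lying strictly below some labelled box. -/
def IsSlideBox (r : P → P → Prop) (D : Set P) (x : P) : Prop :=
  x ∉ D ∧ (∃ d ∈ D, r x d ∧ x ≠ d) ∧
  ∀ y : P, y ∉ D → (∃ d ∈ D, r y d ∧ y ≠ d) → r x y → x = y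

/-- The jeu de taquin slide `j_x` : relation between the labelled configurations
before and after one full slide. -/
def SlideRel (r : P → P → Prop) (A B : Set P × (P → ℕ)) : Prop :=
  ∃ x : P, IsSlideBox r A.1 x ∧
    ∃ e : Cfg P, Relation.ReflTransGen (InnerStep r) ⟨A.1, A.2, x⟩ e ∧
      Terminal r e ∧ B.1 = e.dom ∧ B.2 = e.lab

/-- `R` is a rectification of `T`: it is obtained from `T` by iterating jeu de taquin
slides, and its shape is an order ideal. -/
def RectifiesTo (r : P → P → Prop) (T R : Tab r) : Prop :=
  Relation.ReflTransGen (SlideRel r) (T.dom, T.lab) (R.dom, R.lab) ∧ IsIdeal r R.dom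

/-- The poset has the jeu de taquin property: the rectification of any standard tableau
is independent of all choices made while performing the slides. -/
def HasJdt (r : P → P → Prop) : Prop :=
  ∀ T R R' : Tab r, RectifiesTo r T R → RectifiesTo r T R' → R.dom = R'.dom ∧ R.lab = R'.lab

open scoped Classical in
/-- The jeu de taquin number `t_{λ,μ}^ν`, relative to a choice `U` of a standard tableau
of each straight shape: the number of standard tableaux of skew shape `ν/λ` whose
rectification is `U μ`; it is `0` if `λ ⊄ ν`. -/
noncomputable def tP (r : P → P → Prop) (U : Set P → Tab r) (lam mu nu : Set P) : ℕ :=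
  if lam ⊆ nu then
    Set.ncard {T : Tab r | T.dom = nu \ lam ∧ RectifiesTo r T (U mu)}
  else 0

end JDT

/-! ## Symmetrizable generalized Cartan matrices and their Weyl groups -/

/-- A symmetrizable generalized Cartan matrix `a i j = ⟨α_j, α_i^∨⟩`, together with a
symmetrizer `d` (so that `(α_i, α_j) = d i * a i j` is a symmetric bilinear form with
`(α_i, α_i) = 2 * d i`). -/
structure SGCM (I : Type) where
  a : I → I → ℤ
  d : I → ℝ
  a_diag : ∀ i, a i i = 2
  a_offdiag : ∀ i j, i ≠ j → a i j ≤ 0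
  a_zero_iff : ∀ i j, a i j = 0 → a j i = 0
  d_pos : ∀ i, 0 < d i
  symm : ∀ i j, d i * (a i j : ℝ) = d j * (a j i : ℝ)

variable {I : Type}

/-- The squared length `(α_i, α_i)` of the `i`-th simple root. -/
def SGCM.normSq (G : SGCM I) (i : I) : ℝ := 2 * G.d i

/-- The dual (transposed) generalized Cartan matrix, corresponding to exchanging
roots and coroots. -/
noncomputable def SGCM.dual (G : SGCM I) : SGCM I where
  a i j := G.a j i
  d i := (G.d i)⁻¹
  a_diag i := G.a_diag i
  a_offdiag i j h := G.a_offdiag j i (Ne.symm h)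
  a_zero_iff i j h := G.a_zero_iff j i h
  d_pos i := inv_pos.mpr (G.d_pos i)
  symm i j := by
    have h := G.symm j i
    have hi : G.d i ≠ 0 := ne_of_gt (G.d_pos i)
    have hj : G.d j ≠ 0 := ne_of_gt (G.d_pos j)
    rw [inv_mul_eq_div, inv_mul_eq_div, div_eq_div_iff hi hj]
    linear_combination h

/-- The simple reflection `s_i` acting on weight coordinates: a weight `λ` is recorded
by its pairings `λ j = ⟨λ, α_j^∨⟩` with the simple coroots, and
`⟨s_i λ, α_j^∨⟩ = ⟨λ, α_j^∨⟩ - ⟨λ, α_i^∨⟩ ⟨α_i, α_j^∨⟩`. -/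
def SGCM.srefl (G : SGCM I) (i : I) : Equiv.Perm (I → ℝ) :=
  Function.Involutive.toPerm (fun lam j => lam j - lam i * (G.a j i : ℝ)) (by
    intro lam
    funext j
    have h2 : ((G.a i i : ℤ) : ℝ) = 2 := by rw [G.a_diag i]; norm_num
    dsimp only
    rw [h2]
    ring)

/-- The product `s_{l 1} ⋯ s_{l n}` of the simple reflections along a word. -/
def SGCM.wordProd (G : SGCM I) (l : List I) : Equiv.Perm (I → ℝ) :=
  (l.map G.srefl).prod

/-- The length of an element of the Weyl group: the minimal length of a word of simple
reflections expressing it. -/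
noncomputable def SGCM.length (G : SGCM I) (w : Equiv.Perm (I → ℝ)) : ℕ :=
  sInf {n | ∃ l : List I, l.length = n ∧ G.wordProd l = w}

/-- A word is reduced if no shorter word has the same product. -/
def SGCM.IsReduced (G : SGCM I) (l : List I) : Prop :=
  G.length (G.wordProd l) = l.length

/-- `w` belongs to the Weyl group (is a product of simple reflections). -/
def SGCM.InW (G : SGCM I) (w : Equiv.Perm (I → ℝ)) : Prop :=
  ∃ l : List I, G.wordProd l = w

/-- The (strong) Bruhat order on the Weyl group, via the subword property. -/
def SGCM.bruhatLE (G : SGCM I) (u w : Equiv.Perm (I → ℝ)) : Prop :=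
  ∃ l : List I, G.IsReduced l ∧ G.wordProd l = w ∧
    ∃ l' : List I, l'.Sublist l ∧ G.wordProd l' = u

/-- Peterson's condition: the word `[β_1, …, β_l]` satisfies
`s_{β_k} s_{β_{k+1}} ⋯ s_{β_l} (Λ) = s_{β_{k+1}} ⋯ s_{β_l} (Λ) - β_k`, i.e.
`⟨s_{β_{k+1}} ⋯ s_{β_l} (Λ), β_k^∨⟩ = 1`, for every `k`. -/
def SGCM.MinusculeWord (G : SGCM I) (Λ : I → ℝ) : List I → Prop
  | [] => True
  | j :: l => G.MinusculeWord Λ l ∧ G.wordProd l Λ j = 1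

/-- `w` is `Λ`-minuscule. -/
def SGCM.IsMinuscule (G : SGCM I) (Λ : I → ℝ) (w : Equiv.Perm (I → ℝ)) : Prop :=
  ∃ l : List I, G.IsReduced l ∧ G.wordProd l = w ∧ G.MinusculeWord Λ l

/-- `w` is `Λ`-cominuscule: it is `Λ^∨`-minuscule for the dual root system (where the
coweight `Λ^∨ = Σ Λ_i ϖ_i^∨` has the same coordinate function as `Λ`). -/
def SGCM.IsCominuscule (G : SGCM I) (Λ : I → ℝ) (w : Equiv.Perm (I → ℝ)) : Prop :=
  ∃ l : List I, G.IsReduced l ∧ G.wordProd l = w ∧ G.dual.MinusculeWord Λ l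

/-- `w` is `Λ`-minuscule or `Λ`-cominuscule. -/
def SGCM.IsCoMin (G : SGCM I) (Λ : I → ℝ) (w : Equiv.Perm (I → ℝ)) : Prop :=
  G.IsMinuscule Λ w ∨ G.IsCominuscule Λ w

/-- The simple reflection `s_i` acting on the root lattice `⊕ ℤ α_j` (an element is
recorded by its coordinates on the simple roots):
`s_i (x) = x - ⟨x, α_i^∨⟩ α_i` with `⟨Σ c_j α_j, α_i^∨⟩ = Σ c_j * a i j`. -/
noncomputable def SGCM.qrefl (G : SGCM I) (i : I) : Equiv.Perm (I →₀ ℤ) :=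
  Function.Involutive.toPerm
    (fun x => x - Finsupp.single i (x.sum fun j c => c * G.a i j))
    (by
      intro x
      dsimp only
      have hsub : ∀ y z : I →₀ ℤ,
          ((y - z).sum fun j c => c * G.a i j)
            = (y.sum fun j c => c * G.a i j) - (z.sum fun j c => c * G.a i j) :=
        fun y z => Finsupp.sum_sub_index (fun a b₁ b₂ => by ring)
      have hsingle : ∀ c : ℤ,
          ((Finsupp.single i c).sum fun j c' => c' * G.a i j) = c * 2 := by
        intro c
        rw [Finsupp.sum_single_index (by ring), G.a_diag i]
      rw [hsub, hsingle]
      have h : (x.sum fun j c => c * G.a i j) - (x.sum fun j c => c * G.a i j) * 2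
          = -(x.sum fun j c => c * G.a i j) := by ring
      rw [h, Finsupp.single_neg]
      abel)

/-- The product of the simple reflections along a word, acting on the root lattice. -/
noncomputable def SGCM.qword (G : SGCM I) (l : List I) : Equiv.Perm (I →₀ ℤ) :=
  (l.map G.qrefl).prod

/-! ## Heaps of fully commutative elements -/

/-- Generating relation for the heap order on the positions of a word: position `p` is
below position `q` when `p` comes later in the word and the corresponding simple
reflections do not commute. -/
def heapBelow (G : SGCM I) (l : List I) (p q : Fin l.length) : Prop :=
  q.1 < p.1 ∧ G.srefl (l.get p) * G.srefl (l.get q) ≠ G.srefl (l.get q) * G.srefl (l.get p)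

/-- The heap order on the positions of a word. -/
def heapLE (G : SGCM I) (l : List I) : Fin l.length → Fin l.length → Prop :=
  Relation.ReflTransGen (heapBelow G l)

/-- The subword of `l` consisting of the positions in `S`, in the order of the word. -/
noncomputable def idealWord (l : List I) (S : Set (Fin l.length)) : List I :=
  ((List.finRange l.length).filter fun p => @decide (p ∈ S) (Classical.propDecidable _)).map
    l.get

open scoped Classical in
/-- The number `m(w)` attached to a `Λ`-(co)minuscule element with reduced word `l`:
the product of `(α, α) / (α_p, α_p)` over all pairs `(p, α)` where `p` is a position of
the word, `α` is a simple root with `⟨Λ, α^∨⟩ > 0` and `(α, α) > (α_p, α_p)`, and `p`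
lies above the minimal `α`-coloured element `(α, 1)` of the heap (here `q` runs over the
positions and the first condition states that `q = (α, 1)` for `α` the colour of `q`). -/
noncomputable def mNum (G : SGCM I) (Λ : I → ℝ) (l : List I) : ℝ :=
  ∏ pq : Fin l.length × Fin l.length,
    if (∀ r, l.get r = l.get pq.2 → heapLE G l pq.2 r) ∧
        0 < Λ (l.get pq.2) ∧
        G.normSq (l.get pq.1) < G.normSq (l.get pq.2) ∧
        heapLE G l pq.2 pq.1
    then G.normSq (l.get pq.2) / G.normSq (l.get pq.1)
    else 1

/-! ## Jeu de taquin numbers for (co)minuscule elements -/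

/-- A valid system of choices for computing jeu de taquin numbers of `Λ`-(co)minuscule
elements: `wrd w` is a reduced word for `w`; for `u ≤ w`, `idl w u` is the order ideal
of the heap of `w` corresponding to `u`, and `tab w u` is a standard tableau whose shape
is that ideal. -/
def ValidChoices (G : SGCM I) (Λ : I → ℝ)
    (wrd : Equiv.Perm (I → ℝ) → List I)
    (idl : (w u : Equiv.Perm (I → ℝ)) → Set (Fin (wrd w).length))
    (tab : (w u : Equiv.Perm (I → ℝ)) → JDT.Tab (heapLE G (wrd w))) : Prop :=
  (∀ w, G.IsCoMin Λ w → G.IsReduced (wrd w) ∧ G.wordProd (wrd w) = w) ∧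
  (∀ w u, G.IsCoMin Λ w → G.bruhatLE u w →
      JDT.IsIdeal (heapLE G (wrd w)) (idl w u) ∧
      G.wordProd (idealWord (wrd w) (idl w u)) = u) ∧
  (∀ w u, G.IsCoMin Λ w → G.bruhatLE u w → (tab w u).dom = idl w u)

open scoped Classical in
/-- The jeu de taquin number `t_{u,v}^w` of three Weyl group elements, computed in the
heap of `w`: the number of standard tableaux of shape `H(w)/λ(u)` rectifying to the
chosen standard tableau of shape `λ(v)`; it is `0` unless `u ≤ w` and `v ≤ w`. -/
noncomputable def tE (G : SGCM I)
    (wrd : Equiv.Perm (I → ℝ) → List I)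
    (idl : (w u : Equiv.Perm (I → ℝ)) → Set (Fin (wrd w).length))
    (tab : (w u : Equiv.Perm (I → ℝ)) → JDT.Tab (heapLE G (wrd w)))
    (u v w : Equiv.Perm (I → ℝ)) : ℕ :=
  if G.bruhatLE u w ∧ G.bruhatLE v w then
    Set.ncard {T : JDT.Tab (heapLE G (wrd w)) |
      T.dom = Set.univ \ idl w u ∧ JDT.RectifiesTo (heapLE G (wrd w)) T (tab w v)}
  else 0

/-- The number `m_{u,v}^w = m(w) / (m(u) · m(v))`. -/
noncomputable def mQuot (G : SGCM I) (Λ : I → ℝ)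
    (wrd : Equiv.Perm (I → ℝ) → List I)
    (u v w : Equiv.Perm (I → ℝ)) : ℝ :=
  mNum G Λ (wrd w) / (mNum G Λ (wrd u) * mNum G Λ (wrd v))

/-- The set `S(x)` of simple roots `α` such that `⟨x(Λ), α^∨⟩ ≥ 0`. -/
def Sx (G : SGCM I) (Λ : I → ℝ) (x : Equiv.Perm (I → ℝ)) : Set I :=
  {α : I | 0 ≤ x Λ α}

/-- The restriction of a symmetrizable GCM to a subset of the index set. -/
def SGCM.restrict (G : SGCM I) (S : Set I) : SGCM ↥S where
  a i j := G.a i.1 j.1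
  d i := G.d i.1
  a_diag i := G.a_diag i.1
  a_offdiag i j h := G.a_offdiag i.1 j.1 (fun hv => h (Subtype.ext hv))
  a_zero_iff i j h := G.a_zero_iff i.1 j.1 h
  d_pos i := G.d_pos i.1
  symm i j := G.symm i.1 j.1

end KM

namespace KM

variable {I : Type}

namespace SGCM

/-! ## Words in the simple reflections -/

section Words

variable (G : SGCM I)

lemma srefl_apply (i : I) (lam : I → ℝ) (j : I) :
    G.srefl i lam j = lam j - lam i * (G.a j i : ℝ) := rfl

lemma srefl_apply_self (i : I) (lam : I → ℝ) : G.srefl i lam i = -lam i := by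
  rw [srefl_apply, G.a_diag]
  push_cast
  ring

lemma srefl_mul_self (i : I) : G.srefl i * G.srefl i = 1 := by
  ext lam j
  simp only [Equiv.Perm.mul_apply, srefl_apply, G.a_diag, Equiv.Perm.one_apply]
  push_cast
  ring

lemma srefl_inv (i : I) : (G.srefl i)⁻¹ = G.srefl i :=
  inv_eq_of_mul_eq_one_left (G.srefl_mul_self i)

@[simp] lemma wordProd_nil : G.wordProd [] = 1 := rfl

@[simp] lemma wordProd_cons (i : I) (l : List I) :
    G.wordProd (i :: l) = G.srefl i * G.wordProd l := by
  simp [wordProd]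

@[simp] lemma wordProd_append (l l' : List I) :
    G.wordProd (l ++ l') = G.wordProd l * G.wordProd l' := by
  simp [wordProd]

lemma wordProd_reverse (l : List I) : G.wordProd l.reverse = (G.wordProd l)⁻¹ := by
  induction l with
  | nil => simp
  | cons i l ih => simp [ih, srefl_inv]

lemma length_wordProd_le (l : List I) : G.length (G.wordProd l) ≤ l.length :=
  Nat.sInf_le ⟨l, rfl, rfl⟩

lemma exists_reduced_word (l : List I) :
    ∃ l' : List I, l'.length = G.length (G.wordProd l) ∧ G.wordProd l' = G.wordProd l :=
  Nat.sInf_mem (s := {n | ∃ l' : List I, l'.length = n ∧ G.wordProd l' = G.wordProd l})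
    ⟨l.length, l, rfl, rfl⟩

variable {G}

lemma IsReduced.length_le {l l' : List I} (h : G.IsReduced l)
    (h' : G.wordProd l' = G.wordProd l) : l.length ≤ l'.length := by
  rw [← h, ← h']
  exact G.length_wordProd_le l'

lemma IsReduced.of_append_right {p l : List I} (h : G.IsReduced (p ++ l)) : G.IsReduced l := by
  obtain ⟨l', hl', hw⟩ := G.exists_reduced_word l
  have h1 := h.length_le (l' := p ++ l') (by simp [hw])
  have h2 := G.length_wordProd_le l
  simp only [List.length_append] at h1
  unfold IsReduced
  lia

lemma IsReduced.reverse {l : List I} (h : G.IsReduced l) : G.IsReduced l.reverse := by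
  obtain ⟨l', hl', hw⟩ := G.exists_reduced_word l.reverse
  have h1 := h.length_le (l' := l'.reverse) (by
    rw [wordProd_reverse, hw, wordProd_reverse, inv_inv])
  have h2 := G.length_wordProd_le l.reverse
  simp only [List.length_reverse] at h1 h2
  unfold IsReduced
  simp only [List.length_reverse]
  lia

variable (G)

lemma wordProd_add_smul (l : List I) (lam mu : I → ℝ) (c : ℝ) :
    G.wordProd l (lam + c • mu) = G.wordProd l lam + c • G.wordProd l mu := by
  induction l with
  | nil => simp
  | cons i l ih =>
    funext j
    simp only [wordProd_cons, Equiv.Perm.mul_apply, ih, srefl_apply, Pi.add_apply, Pi.smul_apply,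
      smul_eq_mul]
    ring

lemma exists_int_wordProd (l : List I) (lam : I → ℝ) (h : ∀ j, ∃ n : ℤ, lam j = n) (j : I) :
    ∃ n : ℤ, G.wordProd l lam j = n := by
  induction l generalizing j with
  | nil => simpa using h j
  | cons i l ih =>
    obtain ⟨m, hm⟩ := ih j
    obtain ⟨n, hn⟩ := ih i
    refine ⟨m - n * G.a j i, ?_⟩
    simp only [wordProd_cons, Equiv.Perm.mul_apply, srefl_apply, hm, hn]
    push_cast
    ring

end Words

/-! ## Rank two -/

/-- The alternating word `i j i ⋯` with `n` letters. -/
def altWord (i j : I) : ℕ → List I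
  | 0 => []
  | n + 1 => i :: altWord j i n

lemma length_altWord (i j : I) (n : ℕ) : (altWord i j n).length = n := by
  induction n generalizing i j with
  | zero => rfl
  | succ n ih => simp [altWord, ih]

lemma exists_altWord_eq_append (i j : I) {m n : ℕ} (h : m ≤ n) :
    ∃ r, altWord i j n = altWord i j m ++ r := by
  induction m generalizing i j n with
  | zero => exact ⟨_, rfl⟩
  | succ m ih =>
    obtain ⟨n, rfl⟩ : ∃ k, n = k + 1 := ⟨n - 1, by lia⟩
    obtain ⟨r, hr⟩ := ih j i (n := n) (by lia)
    exact ⟨r, by simp [altWord, hr]⟩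

section RankTwo

variable (G : SGCM I)

lemma altWord_nonneg_of_four_le {i j : I} (hij : i ≠ j) (h4 : 4 ≤ G.a i j * G.a j i)
    (mu : I → ℝ) (hi : 0 ≤ mu i) (hj : 0 ≤ mu j) (n : ℕ) :
    0 ≤ G.wordProd (altWord i j n) mu j ∧
      0 ≤ -(G.a i j : ℝ) * G.wordProd (altWord i j n) mu j
        + 2 * G.wordProd (altWord i j n) mu i := by
  induction n generalizing i j with
  | zero =>
    have h : (G.a i j : ℝ) ≤ 0 := by exact_mod_cast G.a_offdiag i j hij
    simp only [altWord, wordProd_nil, Equiv.Perm.one_apply]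
    exact ⟨hj, by nlinarith⟩
  | succ n ih =>
    obtain ⟨h1, h2⟩ := ih hij.symm (by linarith [mul_comm (G.a i j) (G.a j i)]) hj hi
    have h : (G.a i j : ℝ) ≤ 0 := by exact_mod_cast G.a_offdiag i j hij
    have h4' : (4 : ℝ) ≤ G.a i j * G.a j i := by exact_mod_cast h4
    have h' : (G.a j i : ℝ) ≤ 0 := by exact_mod_cast G.a_offdiag j i hij.symm
    simp only [altWord, wordProd_cons, Equiv.Perm.mul_apply, srefl_apply_self, srefl_apply]
    set x := G.wordProd (altWord j i n) mu i
    set y := G.wordProd (altWord j i n) mu j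
    constructor
    · nlinarith
    · nlinarith [mul_nonneg (neg_nonneg.2 h) h2, mul_nonneg (sub_nonneg.2 h4') h1]

/-- The order of `s_i s_j` is `2`, `3`, `4` or `6` if `a i j * a j i < 4`, and the
coroots of the rank two system are positive up to the longest element. -/
lemma exists_braid {i j : I} (hij : i ≠ j) (h4 : G.a i j * G.a j i < 4) :
    ∃ m, 0 < m ∧ G.wordProd (altWord i j m) = G.wordProd (altWord j i m) ∧
      ∀ n < m, ∀ mu : I → ℝ, 0 ≤ mu i → 0 ≤ mu j →
        0 ≤ G.wordProd (altWord i j n) mu j := by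
  have h1 := G.a_offdiag i j hij
  have h2 := G.a_offdiag j i hij.symm
  have hz := G.a_zero_iff i j
  have hz' := G.a_zero_iff j i
  have key : (G.a i j = 0 ∧ G.a j i = 0) ∨ (G.a i j = -1 ∧ G.a j i = -1) ∨
      (G.a i j = -1 ∧ G.a j i = -2) ∨ (G.a i j = -2 ∧ G.a j i = -1) ∨
      (G.a i j = -1 ∧ G.a j i = -3) ∨ (G.a i j = -3 ∧ G.a j i = -1) := by
    rcases eq_or_ne (G.a i j) 0 with h0 | h0
    · exact Or.inl ⟨h0, hz h0⟩
    · have h0' : G.a j i ≠ 0 := fun h => h0 (hz' h)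
      have hi : G.a i j ≤ -1 := by lia
      have hj : G.a j i ≤ -1 := by lia
      have hi' : -3 ≤ G.a i j := by nlinarith
      have hj' : -3 ≤ G.a j i := by nlinarith
      interval_cases G.a i j <;> interval_cases G.a j i <;> simp_all
  have hii := G.a_diag i
  have hjj := G.a_diag j
  rcases key with ⟨ha, hb⟩ | ⟨ha, hb⟩ | ⟨ha, hb⟩ | ⟨ha, hb⟩ | ⟨ha, hb⟩ | ⟨ha, hb⟩ <;>
    [refine ⟨2, by norm_num, ?_, ?_⟩; refine ⟨3, by norm_num, ?_, ?_⟩;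
      refine ⟨4, by norm_num, ?_, ?_⟩; refine ⟨4, by norm_num, ?_, ?_⟩;
      refine ⟨6, by norm_num, ?_, ?_⟩; refine ⟨6, by norm_num, ?_, ?_⟩]
  all_goals first
    | ext lam x
      simp only [altWord, wordProd_cons, wordProd_nil, mul_one, Equiv.Perm.mul_apply, srefl_apply,
        ha, hb, hii, hjj]
      push_cast
      ring
    | intro n hn mu hi hj
      interval_cases n <;>
      · simp only [altWord, wordProd_cons, wordProd_nil, mul_one, Equiv.Perm.mul_apply,
          srefl_apply, Equiv.Perm.one_apply, ha, hb, hii, hjj]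
        try push_cast
        linarith

variable {G} in
/-- Factor a Weyl group element into an element of the dihedral subgroup generated by `s_i`
and `s_j` and a minimal coset representative. -/
lemma IsReduced.exists_dihedral_factor {l : List I} (h : G.IsReduced l) (i j : I) :
    ∃ n v, (G.wordProd l = G.wordProd (altWord i j n ++ v) ∨
        G.wordProd l = G.wordProd (altWord j i n ++ v)) ∧
      l.length = n + v.length ∧
      G.length (G.wordProd v) ≤ G.length (G.wordProd (i :: v)) ∧
      G.length (G.wordProd v) ≤ G.length (G.wordProd (j :: v)) := by
  induction hN : l.length using Nat.strong_induction_on generalizing l i j with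
  | _ N ih =>
    have step : ∀ i j, G.length (G.wordProd (i :: l)) < G.length (G.wordProd l) →
        ∃ n v, (G.wordProd l = G.wordProd (altWord i j n ++ v) ∨
            G.wordProd l = G.wordProd (altWord j i n ++ v)) ∧
          N = n + v.length ∧
          G.length (G.wordProd v) ≤ G.length (G.wordProd (i :: v)) ∧
          G.length (G.wordProd v) ≤ G.length (G.wordProd (j :: v)) := by
      intro i j hd
      obtain ⟨l1, hl1, hw1⟩ := G.exists_reduced_word (i :: l)
      have hw : G.wordProd l = G.wordProd (i :: l1) := by
        rw [wordProd_cons, hw1, wordProd_cons, ← mul_assoc, srefl_mul_self, one_mul]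
      have hle := h.length_le hw.symm
      rw [h] at hd
      simp only [List.length_cons] at hle
      have hred1 : G.IsReduced l1 := by
        unfold IsReduced
        rw [hw1, hl1]
      obtain ⟨n, v, hor, hlen, hvi, hvj⟩ := ih l1.length (by lia) hred1 i j rfl
      rcases hor with hor | hor
      · cases n with
        | zero => exact ⟨1, v, Or.inl (by rw [hw, wordProd_cons, hor]; simp [altWord]), by lia,
            hvi, hvj⟩
        | succ n =>
          have := h.length_le (l' := altWord j i n ++ v) (by
            rw [hw, wordProd_cons, hor]
            simp only [altWord, List.cons_append, wordProd_cons]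
            rw [← mul_assoc, srefl_mul_self, one_mul])
          simp only [List.length_append, length_altWord] at this
          lia
      · exact ⟨n + 1, v, Or.inl (by rw [hw, wordProd_cons, hor]; simp [altWord]), by lia,
          hvi, hvj⟩
    by_cases hi : G.length (G.wordProd (i :: l)) < G.length (G.wordProd l)
    · exact step i j hi
    by_cases hj : G.length (G.wordProd (j :: l)) < G.length (G.wordProd l)
    · obtain ⟨n, v, hor, hlen, hvj, hvi⟩ := step j i hj
      exact ⟨n, v, hor.symm, hlen, hvi, hvj⟩
    · exact ⟨0, l, Or.inl (by simp [altWord]), by lia, not_lt.1 hi, not_lt.1 hj⟩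

end RankTwo

/-! ## Positivity of coroots and inversions -/

section Positivity

variable (G : SGCM I)

/-- If `ℓ(s_j w) ≥ ℓ(w)`, then the coroot `w⁻¹ α_j^∨` is positive: it is nonnegative on
dominant weights. -/
theorem wordProd_nonneg {l : List I} {j : I}
    (h : G.length (G.wordProd l) ≤ G.length (G.wordProd (j :: l)))
    {lam : I → ℝ} (hlam : ∀ x, 0 ≤ lam x) : 0 ≤ G.wordProd l lam j := by
  induction hN : G.length (G.wordProd l) using Nat.strong_induction_on generalizing l j with
  | _ N ih =>
    obtain ⟨l', hlen, hw⟩ := G.exists_reduced_word l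
    rw [wordProd_cons] at h
    rw [← hw] at h hN ⊢
    have hred : G.IsReduced l' := by
      unfold IsReduced
      rw [hw, hlen]
    rw [hred] at hN h
    have hdesc : ∀ t, G.wordProd l' = G.wordProd (j :: t) → l'.length ≤ t.length := by
      intro t ht
      rw [ht, wordProd_cons, ← mul_assoc, srefl_mul_self, one_mul] at h
      exact h.trans (G.length_wordProd_le t)
    cases l' with
    | nil => simpa using hlam j
    | cons i t =>
      have hij : i ≠ j := by
        rintro rfl
        have := hdesc t rfl
        simp at this
      obtain ⟨n, v, hor, hnv, hvi, hvj⟩ := hred.exists_dihedral_factor i j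
      have hn : n ≠ 0 := by
        rintro rfl
        have hv : G.wordProd (i :: t) = G.wordProd v := by simpa [altWord] using hor
        rw [wordProd_cons, ← hv, wordProd_cons, ← mul_assoc, srefl_mul_self, one_mul,
          ← wordProd_cons, hred] at hvi
        have := G.length_wordProd_le t
        simp only [List.length_cons] at hvi
        lia
      have hlt : G.length (G.wordProd v) < N := by
        have := G.length_wordProd_le v
        lia
      have hpi := ih _ hlt hvi rfl
      have hpj := ih _ hlt hvj rfl
      rcases hor with hor | hor
      · rw [hor, wordProd_append, Equiv.Perm.mul_apply]
        by_cases h4 : 4 ≤ G.a i j * G.a j i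
        · exact (G.altWord_nonneg_of_four_le hij h4 _ hpi hpj n).1
        · obtain ⟨m, hm, hbr, hpos⟩ := G.exists_braid hij (not_le.1 h4)
          refine hpos n ?_ _ hpi hpj
          by_contra! hmn
          obtain ⟨r, hr⟩ := exists_altWord_eq_append i j hmn
          obtain ⟨m, rfl⟩ : ∃ k, m = k + 1 := ⟨m - 1, by lia⟩
          have hlenr := congrArg List.length hr
          have := hdesc (altWord i j m ++ r ++ v) (by
            rw [hor, hr, wordProd_append, wordProd_append, hbr]
            simp [altWord, mul_assoc])
          simp only [List.length_append, length_altWord] at this hlenr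
          lia
      · obtain ⟨n, rfl⟩ : ∃ k, n = k + 1 := ⟨n - 1, by lia⟩
        have := hdesc (altWord i j n ++ v) (by rw [hor]; simp [altWord])
        simp only [List.length_append, length_altWord] at this
        lia

variable {G} in
lemma IsReduced.wordProd_nonneg {l : List I} {j : I} (h : G.IsReduced (j :: l))
    {lam : I → ℝ} (hlam : ∀ x, 0 ≤ lam x) : 0 ≤ G.wordProd l lam j := by
  refine G.wordProd_nonneg ?_ hlam
  rw [h]
  have := G.length_wordProd_le l
  simp only [List.length_cons]
  lia

/-- Every real coroot is positive or negative. -/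
lemma wordProd_nonneg_or_nonpos (l : List I) (j : I) :
    (∀ lam : I → ℝ, (∀ x, 0 ≤ lam x) → 0 ≤ G.wordProd l lam j) ∨
      (∀ lam : I → ℝ, (∀ x, 0 ≤ lam x) → G.wordProd l lam j ≤ 0) := by
  rcases le_total (G.length (G.wordProd l)) (G.length (G.wordProd (j :: l))) with h | h
  · exact Or.inl fun lam hlam => G.wordProd_nonneg h hlam
  · right
    intro lam hlam
    have := G.wordProd_nonneg (l := j :: l) (j := j) (by
      rwa [G.wordProd_cons j (j :: l), G.wordProd_cons j l, ← mul_assoc, srefl_mul_self,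
        one_mul, ← wordProd_cons]) hlam
    rw [wordProd_cons, Equiv.Perm.mul_apply, srefl_apply_self] at this
    linarith

lemma wordProd_apply_eq_of_nonneg (l : List I) (j : I) {b : I} {c : ℝ}
    (h : ∀ lam : I → ℝ, (∀ x, 0 ≤ lam x) → G.wordProd l lam j = c * lam b) (lam : I → ℝ) :
    G.wordProd l lam j = c * lam b := by
  have hdec : lam = (fun x => max (lam x) 0) + (-1 : ℝ) • (fun x => max (-lam x) 0) := by
    funext x
    simp only [Pi.add_apply, Pi.smul_apply, smul_eq_mul]
    rcases le_total (lam x) 0 with hx | hx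
    · rw [max_eq_right hx, max_eq_left (by linarith)]
      ring
    · rw [max_eq_left hx, max_eq_right (by linarith)]
      ring
  have hb : lam b = max (lam b) 0 + -1 * max (-lam b) 0 := congrFun hdec b
  conv_lhs => rw [hdec]
  rw [wordProd_add_smul, Pi.add_apply, Pi.smul_apply, h _ fun x => le_max_right _ _,
    h _ fun x => le_max_right _ _, smul_eq_mul]
  linear_combination -c * hb

open scoped Classical in
/-- The simple coroot `α_b^∨` is the only positive real coroot made negative by `s_b`. -/
lemma wordProd_apply_eq_of_srefl_nonpos (l : List I) (j b : I)
    (hpos : ∀ lam : I → ℝ, (∀ x, 0 ≤ lam x) → 0 ≤ G.wordProd l lam j)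
    (hneg : ∀ lam : I → ℝ, (∀ x, 0 ≤ lam x) → G.wordProd l (G.srefl b lam) j ≤ 0)
    (lam : I → ℝ) : G.wordProd l lam j = lam b := by
  set e : I → I → ℝ := fun y x => if x = y then 1 else 0 with he
  set c := G.wordProd l (e b) j with hc
  have h_int : ∀ y x, ∃ n : ℤ, e y x = n := by
    intro y x
    by_cases h : x = y
    · exact ⟨1, by simp [he, h]⟩
    · exact ⟨0, by simp [he, h]⟩
  have hker : ∀ mu : I → ℝ, (∀ x, 0 ≤ mu x) → mu b = 0 → G.wordProd l mu j = 0 := by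
    intro mu hmu hb
    refine le_antisymm ?_ (hpos mu hmu)
    have hfix : G.srefl b mu = mu := by
      funext x
      rw [srefl_apply, hb]
      ring
    simpa [hfix] using hneg mu hmu
  have hlin : ∀ mu : I → ℝ, G.wordProd l mu j = c * mu b := by
    refine fun mu => G.wordProd_apply_eq_of_nonneg l j (fun mu hmu => ?_) mu
    have hdec : mu = (fun x => if x = b then 0 else mu x) + mu b • e b := by
      funext x
      by_cases hx : x = b
      · simp [he, hx]
      · simp [he, hx]
    conv_lhs => rw [hdec]
    rw [wordProd_add_smul, Pi.add_apply, hker _ (fun x => ?_) (by simp), Pi.smul_apply,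
      smul_eq_mul, ← hc]
    · ring
    · by_cases hx : x = b
      · simp [hx]
      · simpa [hx] using hmu x
  obtain ⟨n, hn⟩ := G.exists_int_wordProd l (e b) (h_int b) j
  obtain ⟨m, hm⟩ := G.exists_int_wordProd l.reverse (e j) (h_int j) b
  have h1 := hlin (G.wordProd l.reverse (e j))
  rw [← Equiv.Perm.mul_apply, wordProd_reverse, mul_inv_cancel, ← wordProd_reverse, hm, hc, hn]
    at h1
  have hnm : n * m = 1 := by
    have h2 : (1 : ℝ) = n * m := by simpa [he] using h1
    exact_mod_cast h2.symm
  have hn0 : 0 ≤ n := by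
    have h0 : 0 ≤ G.wordProd l (e b) j := hpos _ fun x => by
      simp only [he]
      split_ifs <;> norm_num
    rw [hn] at h0
    exact_mod_cast h0
  have hn1 : n = 1 := by
    rcases Int.eq_one_or_neg_one_of_mul_eq_one hnm with h | h <;> lia
  rw [hlin, hc, hn, hn1]
  simp

lemma minusculeWord_append_singleton (Λ : I → ℝ) (l : List I) (b : I) :
    G.MinusculeWord Λ (l ++ [b]) ↔ G.MinusculeWord (G.srefl b Λ) l ∧ Λ b = 1 := by
  induction l with
  | nil => simp [MinusculeWord]
  | cons i l ih =>
    simp only [List.cons_append, MinusculeWord, ih, wordProd_append, wordProd_cons, wordProd_nil,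
      mul_one, Equiv.Perm.mul_apply]
    tauto

lemma minusculeWord_of_split (Λ : I → ℝ) (l : List I)
    (h : ∀ p j t, l = p ++ j :: t → G.wordProd t Λ j = 1) : G.MinusculeWord Λ l := by
  induction l with
  | nil => trivial
  | cons i l ih =>
    exact ⟨ih fun p j t hl => h (i :: p) j t (by simp [hl]), h [] i l rfl⟩

variable {G} in
/-- Along a minuscule word, `Λ` pairs to `1` with every inversion. -/
lemma MinusculeWord.apply_inversion {Λ : I → ℝ} {l : List I} (h : G.MinusculeWord Λ l)
    {u : List I} {x : I}
    (hpos : ∀ lam : I → ℝ, (∀ y, 0 ≤ lam y) → 0 ≤ G.wordProd u lam x)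
    (hneg : ∀ lam : I → ℝ, (∀ y, 0 ≤ lam y) →
      G.wordProd u ((G.wordProd l)⁻¹ lam) x ≤ 0) :
    G.wordProd u Λ x = 1 := by
  induction l using List.reverseRecOn generalizing Λ u with
  | nil =>
    have hzero := G.wordProd_apply_eq_of_nonneg u x (b := x) (c := 0) fun lam hlam => by
      rw [zero_mul]
      exact le_antisymm (by simpa using hneg lam hlam) (hpos lam hlam)
    have := hzero ((G.wordProd u)⁻¹ fun _ => 1)
    simp at this
  | append_singleton l b ih =>
    rw [minusculeWord_append_singleton] at h
    rcases G.wordProd_nonneg_or_nonpos (u ++ [b]) x with hs | hs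
    · have hmul : ∀ lam, G.wordProd (u ++ [b]) lam = G.wordProd u (G.srefl b lam) := by
        simp
      have := ih h.1 hs fun lam hlam => by
        rw [hmul]
        simpa [srefl_inv] using hneg lam hlam
      rwa [hmul, ← Equiv.Perm.mul_apply (G.srefl b), srefl_mul_self, Equiv.Perm.one_apply]
        at this
    · rw [G.wordProd_apply_eq_of_srefl_nonpos u x b hpos (by simpa using hs)]
      exact h.2

variable {G} in
/-- The minuscule condition does not depend on the reduced word. -/
theorem MinusculeWord.of_wordProd_eq {Λ : I → ℝ} {l₀ l : List I} (h : G.MinusculeWord Λ l₀)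
    (hred : G.IsReduced l) (heq : G.wordProd l₀ = G.wordProd l) : G.MinusculeWord Λ l := by
  refine G.minusculeWord_of_split Λ l fun p j t hl => h.apply_inversion ?_ ?_
  · subst hl
    exact fun lam hlam => hred.of_append_right.wordProd_nonneg hlam
  · intro lam hlam
    subst hl
    have hrev := hred.reverse
    rw [List.reverse_append, List.reverse_cons, List.append_assoc] at hrev
    have := IsReduced.wordProd_nonneg (l := p.reverse) hrev.of_append_right hlam
    rw [wordProd_reverse] at this
    rw [heq, wordProd_append, wordProd_cons, mul_inv_rev, mul_inv_rev, srefl_inv,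
      ← Equiv.Perm.mul_apply, ← mul_assoc, ← mul_assoc, mul_inv_cancel, one_mul,
      Equiv.Perm.mul_apply, srefl_apply_self]
    linarith

end Positivity

/-! ## Duality -/

section Duality

variable (G : SGCM I)

lemma dual_wordProd_apply (l : List I) (lam : I → ℝ) (x : I) :
    G.dual.wordProd l lam x = G.d x * G.wordProd l (fun y => lam y / G.d y) x := by
  induction l generalizing x with
  | nil =>
    have := (G.d_pos x).ne'
    simp only [wordProd_nil, Equiv.Perm.one_apply]
    field_simp
  | cons i l ih =>
    simp only [wordProd_cons, Equiv.Perm.mul_apply, srefl_apply, ih]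
    have h := G.symm x i
    simp only [dual]
    linear_combination (G.wordProd l (fun y => lam y / G.d y) i) * h

lemma dual_wordProd_eq_iff (l l' : List I) :
    G.dual.wordProd l = G.dual.wordProd l' ↔ G.wordProd l = G.wordProd l' := by
  constructor
  · intro h
    ext lam x
    have := congrFun (congrArg (fun w : Equiv.Perm (I → ℝ) => w fun y => lam y * G.d y) h) x
    simp only [dual_wordProd_apply] at this
    have hd : (fun y => lam y * G.d y / G.d y) = lam := by
      funext y
      exact mul_div_cancel_right₀ _ (G.d_pos y).ne'
    rw [hd] at this
    exact mul_left_cancel₀ (G.d_pos x).ne' this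
  · intro h
    ext lam x
    rw [dual_wordProd_apply, dual_wordProd_apply, h]

variable {G} in
lemma IsReduced.dual {l : List I} (h : G.IsReduced l) : G.dual.IsReduced l := by
  obtain ⟨l', hlen, hw⟩ := G.dual.exists_reduced_word l
  have h1 := h.length_le ((G.dual_wordProd_eq_iff l' l).1 hw)
  have h2 := G.dual.length_wordProd_le l
  unfold IsReduced
  lia

end Duality

/-! ## Minuscule words for a fundamental weight -/

section Fundamental

variable {G : SGCM I} {iΛ : I} {Λ : I → ℝ}

lemma MinusculeWord.wordProd_apply {l : List I} (h : G.MinusculeWord Λ l) (x : I) :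
    G.wordProd l Λ x = Λ x - ((l.map (G.a x)).sum : ℤ) := by
  induction l with
  | nil => simp
  | cons i l ih =>
    rw [wordProd_cons, Equiv.Perm.mul_apply, srefl_apply, ih h.1, h.2]
    simp only [List.map_cons, List.sum_cons]
    push_cast
    ring

lemma exists_le_of_sum_eq_neg_one {l : List I} {f : I → ℤ} (h0 : ∀ m ∈ l, f m ≤ 0)
    (hs : (l.map f).sum = -1) : ∃ m ∈ l, f m = -1 := by
  induction l with
  | nil => simp at hs
  | cons i l ih =>
    simp only [List.map_cons, List.sum_cons] at hs
    have hi := h0 i (by simp)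
    have hl : (l.map f).sum ≤ 0 := by
      simpa using List.sum_le_card_nsmul (l.map f) 0 fun y hy => by
        obtain ⟨m, hm, rfl⟩ := List.mem_map.1 hy
        exact h0 m (by simp [hm])
    by_cases h : f i = -1
    · exact ⟨i, by simp, h⟩
    · obtain ⟨m, hm, hf⟩ := ih (fun m hm => h0 m (by simp [hm])) (by lia)
      exact ⟨m, by simp [hm], hf⟩

lemma MinusculeWord.d_le {l : List I} (h : G.MinusculeWord Λ l)
    (h0 : ∀ j, j ≠ iΛ → Λ j = 0) {j : I} (hj : j ∈ l) : G.d iΛ ≤ G.d j := by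
  induction l generalizing j with
  | nil => simp at hj
  | cons i l ih =>
    rcases List.mem_cons.1 hj with rfl | hj
    · by_cases hjl : j ∈ l
      · exact ih h.1 hjl
      by_cases hji : j = iΛ
      · rw [hji]
      have hs := h.1.wordProd_apply j
      rw [h.2, h0 j hji] at hs
      have hs' : (l.map (G.a j)).sum = -1 := by
        have : (((l.map (G.a j)).sum : ℤ) : ℝ) = ((-1 : ℤ) : ℝ) := by
          push_cast at hs ⊢
          linarith
        exact_mod_cast this
      have hne : ∀ m ∈ l, j ≠ m := fun m hm hjm => hjl (hjm ▸ hm)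
      obtain ⟨m, hm, ha⟩ :=
        exists_le_of_sum_eq_neg_one (fun m hm => G.a_offdiag j m (hne m hm)) hs'
      refine (ih h.1 hm).trans ?_
      have hsymm := G.symm j m
      have hle : G.a m j ≤ -1 := by
        have h2 := G.a_offdiag m j (hne m hm).symm
        have h3 : G.a m j ≠ 0 := fun hz => by
          have := G.a_zero_iff m j hz
          lia
        lia
      have hle' : (G.a m j : ℝ) ≤ -1 := by exact_mod_cast hle
      rw [ha] at hsymm
      push_cast at hsymm
      nlinarith [G.d_pos m]
    · exact ih h.1 hj

lemma MinusculeWord.getLast_eq {l : List I} (h : G.MinusculeWord Λ l)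
    (h0 : ∀ j, j ≠ iΛ → Λ j = 0) (hl : l ≠ []) : l.getLast hl = iΛ := by
  induction l using List.reverseRecOn with
  | nil => exact absurd rfl hl
  | append_singleton l b _ =>
    rw [minusculeWord_append_singleton] at h
    rw [List.getLast_append_singleton]
    by_contra hb
    rw [h0 b hb] at h
    norm_num at h

/-- A letter of a minuscule word which is not the last one does not commute with some
later letter. -/
lemma MinusculeWord.exists_ne_zero {j : I} {l : List I} (h : G.MinusculeWord Λ (j :: l))
    (h1 : Λ iΛ = 1) (h0 : ∀ j, j ≠ iΛ → Λ j = 0) (hl : l ≠ []) :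
    ∃ m ∈ l, m ≠ j ∧ G.a j m ≠ 0 := by
  by_contra! hc
  have hs := h.1.wordProd_apply j
  rw [h.2] at hs
  have hnn : ∀ m ∈ l, 0 ≤ G.a j m := by
    intro m hm
    by_cases hmj : m = j
    · rw [hmj, G.a_diag]
      norm_num
    · exact (hc m hm hmj).ge
  have hsum : 0 ≤ (l.map (G.a j)).sum := List.sum_nonneg fun y hy => by
    obtain ⟨m, hm, rfl⟩ := List.mem_map.1 hy
    exact hnn m hm
  have hsumR : (0 : ℝ) ≤ ((l.map (G.a j)).sum : ℤ) := by exact_mod_cast hsum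
  by_cases hj : j = iΛ
  · have hlast := h.1.getLast_eq h0 hl
    have hmem : j ∈ l := by
      rw [hj, ← hlast]
      exact List.getLast_mem hl
    have hle : G.a j j ≤ (l.map (G.a j)).sum :=
      List.single_le_sum (fun y hy => by
        obtain ⟨m, hm, rfl⟩ := List.mem_map.1 hy
        exact hnn m hm) _ (List.mem_map.2 ⟨j, hmem, rfl⟩)
    rw [G.a_diag] at hle
    have hleR : (2 : ℝ) ≤ ((l.map (G.a j)).sum : ℤ) := by exact_mod_cast hle
    rw [hj] at hs hleR
    linarith
  · rw [h0 j hj] at hs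
    linarith

lemma MinusculeWord.drop {l : List I} (h : G.MinusculeWord Λ l) (n : ℕ) :
    G.MinusculeWord Λ (l.drop n) := by
  induction n generalizing l with
  | zero => simpa using h
  | succ n ih =>
    cases l with
    | nil => trivial
    | cons i l => exact ih h.1

variable (G) in
open scoped Classical in
lemma a_eq_zero_of_commute {i j : I} (hij : i ≠ j)
    (h : G.srefl i * G.srefl j = G.srefl j * G.srefl i) : G.a i j = 0 := by
  have := congrFun (congrArg
    (fun w : Equiv.Perm (I → ℝ) => w fun y => if y = j then 1 else 0) h) i
  simp only [Equiv.Perm.mul_apply, srefl_apply, G.a_diag, if_neg hij, if_true] at this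
  push_cast at this
  have h2 : (G.a i j : ℝ) = 0 := by linarith
  exact_mod_cast h2

end Fundamental

end SGCM

/-! ## Heaps of cominuscule elements -/

section Heap

variable {G : SGCM I} {iΛ : I} {Λ : I → ℝ} {l : List I}

lemma heapLE.le {p q : Fin l.length} (h : heapLE G l p q) : q ≤ p := by
  induction h with
  | refl => exact le_rfl
  | tail _ hb ih => exact (le_of_lt hb.1).trans ih

/-- The last position of a cominuscule word is the minimum of its heap. -/
lemma heapLE_last_of_cominuscule (h : G.dual.MinusculeWord Λ l) (h1 : Λ iΛ = 1)
    (h0 : ∀ j, j ≠ iΛ → Λ j = 0) {q : Fin l.length} (hq : q.1 + 1 = l.length)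
    (p : Fin l.length) : heapLE G l q p := by
  induction hk : l.length - p.1 using Nat.strong_induction_on generalizing p with
  | _ k ih =>
    by_cases hp : p.1 + 1 = l.length
    · have : p = q := Fin.ext (by lia)
      rw [this]
      exact Relation.ReflTransGen.refl
    have hd := h.drop p.1
    rw [List.drop_eq_getElem_cons p.2] at hd
    obtain ⟨m, hm, hmp, ha⟩ := hd.exists_ne_zero h1 h0 (by
      rw [Ne, List.drop_eq_nil_iff]
      have := p.2
      lia)
    obtain ⟨r, hr, rfl⟩ := List.getElem_of_mem hm
    rw [List.length_drop] at hr
    rw [List.getElem_drop] at ha hmp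
    refine (ih (l.length - (p.1 + 1 + r)) (by lia) ⟨p.1 + 1 + r, by lia⟩ rfl).tail
      ⟨by simp only; lia, fun hc => ha ?_⟩
    exact G.a_eq_zero_of_commute hmp hc

lemma mNum_of_minusculeWord (h : G.MinusculeWord Λ l)
    (h0 : ∀ j, j ≠ iΛ → Λ j = 0) : mNum G Λ l = 1 := by
  refine Finset.prod_eq_one fun pq _ => if_neg ?_
  rintro ⟨-, hΛ, hlt, -⟩
  have hq : l.get pq.2 = iΛ := by
    by_contra hne
    rw [h0 _ hne] at hΛ
    exact lt_irrefl _ hΛ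
  have := h.d_le h0 (List.get_mem l pq.1)
  rw [hq] at hlt
  simp only [SGCM.normSq] at hlt
  linarith

lemma normSq_le_of_cominuscule (h : G.dual.MinusculeWord Λ l)
    (h0 : ∀ j, j ≠ iΛ → Λ j = 0) {j : I} (hj : j ∈ l) : G.normSq j ≤ G.normSq iΛ := by
  have hd : (G.d iΛ)⁻¹ ≤ (G.d j)⁻¹ := h.d_le h0 hj
  rw [inv_le_inv₀ (G.d_pos _) (G.d_pos _)] at hd
  simp only [SGCM.normSq]
  linarith

lemma mNum_of_cominuscule (h : G.dual.MinusculeWord Λ l) (h1 : Λ iΛ = 1)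
    (h0 : ∀ j, j ≠ iΛ → Λ j = 0) :
    mNum G Λ l = ∏ p : Fin l.length, G.normSq iΛ / G.normSq (l.get p) := by
  rw [mNum, Fintype.prod_prod_type]
  refine Finset.prod_congr rfl fun p _ => ?_
  have hl : l ≠ [] := by
    rintro rfl
    exact p.elim0
  have hpos := List.length_pos_iff.2 hl
  have hlt : l.length - 1 < l.length := by lia
  set q : Fin l.length := ⟨l.length - 1, hlt⟩
  have hq : l.get q = iΛ := by
    rw [← h.getLast_eq h0 hl, List.getLast_eq_getElem]
    rfl
  have hmin := heapLE_last_of_cominuscule h h1 h0 (q := q) (by simp only [q]; lia)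
  rw [Finset.prod_eq_single q]
  · split_ifs with hc
    · rw [hq]
    · have hge : ¬ G.normSq (l.get p) < G.normSq iΛ := fun hlt' =>
        hc ⟨fun r _ => hmin r, by rw [hq, h1]; exact one_pos, by rwa [hq], hmin p⟩
      have heq := le_antisymm (normSq_le_of_cominuscule h h0 (List.get_mem l p))
        (not_lt.1 hge)
      have hp : G.normSq iΛ ≠ 0 := (mul_pos two_pos (G.d_pos iΛ)).ne'
      rw [heq, div_self hp]
  · intro r _ hr
    refine if_neg ?_
    rintro ⟨hfirst, hΛ, -, -⟩
    have hri : l.get r = iΛ := by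
      by_contra hne
      simp only [h0 _ hne, lt_irrefl] at hΛ
    have hle : q ≤ r := (hfirst q (hq.trans hri.symm)).le
    refine hr (le_antisymm ?_ hle)
    rw [Fin.le_def]
    have := r.2
    simp only [q]
    lia
  · simp

end Heap

end KM

/-- Let `Λ` be the fundamental weight with simple root `α_Λ`. If `w` is
`Λ`-minuscule then `m(w) = 1`. If `w` is `Λ`-cominuscule with reduced expression
`w = s_{α_1} ⋯ s_{α_l}`, then `m(w) = Π_{i=1}^{l} (α_Λ, α_Λ)/(α_i, α_i)`, and each
factor of this product is `≥ 1`. -/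
theorem statement12 {I : Type} (G : KM.SGCM I) (iΛ : I) (Λ : I → ℝ)
    (hfund : Λ iΛ = 1 ∧ ∀ j : I, j ≠ iΛ → Λ j = 0)
    (w : Equiv.Perm (I → ℝ)) (l : List I)
    (hred : G.IsReduced l) (hl : G.wordProd l = w) :
    (G.IsMinuscule Λ w → KM.mNum G Λ l = 1) ∧
    (G.IsCominuscule Λ w →
      KM.mNum G Λ l = ∏ p : Fin l.length, G.normSq iΛ / G.normSq (l.get p) ∧
      ∀ p : Fin l.length, 1 ≤ G.normSq iΛ / G.normSq (l.get p)) := by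
  obtain ⟨h1, h0⟩ := hfund
  refine ⟨?_, ?_⟩
  · rintro ⟨l₀, -, hl₀, hmin⟩
    exact KM.mNum_of_minusculeWord (hmin.of_wordProd_eq hred (hl₀.trans hl.symm)) h0
  · rintro ⟨l₀, -, hl₀, hmin⟩
    have h := hmin.of_wordProd_eq hred.dual
      ((G.dual_wordProd_eq_iff l₀ l).2 (hl₀.trans hl.symm))
    refine ⟨KM.mNum_of_cominuscule h h1 h0, fun p => ?_⟩
    have hpos : 0 < G.normSq (l.get p) := mul_pos two_pos (G.d_pos _)
    rw [one_le_div hpos]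
    exact KM.normSq_le_of_cominuscule h h0 (List.get_mem l p)
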